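/- Let N ≥ 2 and let U be a unitary on ℂ^N ⊗ ℂ^N with g_t(U) its gate-typicality. For n ≥ 1 define U^(n) = U·W_{n−1}·U ⋯ W_1·U, where each W_j = U^A_j ⊗ U^B_j is a local gate. Then the average of g_t(U^(n)) over all the local unitaries U^A_1,…,U^B_{n−1} drawn independently from the Haar probability measure on the unitary group U(N) equals 1 − (1 − g_t(U))^n. -/

import Mathlib

open Matrix MeasureTheory
open scoped Kronecker

noncomputable section

instance {m n R : Type*} [TopologicalSpace R] : MeasurableSpace (Matrix m n R) := borel _
instance {m n R : Type*} [TopologicalSpace R] : BorelSpace (Matrix m n R) := ⟨rfl⟩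

/-- Reshuffling: `(U_R)_{(i,j),(α,β)} = U_{(i,α),(j,β)}`. -/
def reshuffle (N : ℕ) (U : Matrix (Fin N × Fin N) (Fin N × Fin N) ℂ) :
    Matrix (Fin N × Fin N) (Fin N × Fin N) ℂ :=
  Matrix.of fun p q => U (p.1, q.1) (p.2, q.2)

/-- Partial transpose: `(U_Γ)_{(j,α),(i,β)} = U_{(i,α),(j,β)}`. -/
def ptransp (N : ℕ) (U : Matrix (Fin N × Fin N) (Fin N × Fin N) ℂ) :
    Matrix (Fin N × Fin N) (Fin N × Fin N) ℂ :=
  Matrix.of fun p q => U (q.1, p.2) (p.1, q.2)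

/-- The swap gate `S(x ⊗ y) = y ⊗ x`. -/
def swapGate (N : ℕ) : Matrix (Fin N × Fin N) (Fin N × Fin N) ℂ :=
  Matrix.of fun p q => if p.1 = q.2 ∧ p.2 = q.1 then 1 else 0

/-- `ρ_R(U) = U_R U_R† / N²`. -/
def rhoR (N : ℕ) (U : Matrix (Fin N × Fin N) (Fin N × Fin N) ℂ) :
    Matrix (Fin N × Fin N) (Fin N × Fin N) ℂ :=
  ((N : ℂ) ^ 2)⁻¹ • (reshuffle N U * (reshuffle N U)ᴴ)

/-- `ρ_T(U) = S U_Γ U_Γ† S / N²`. -/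
def rhoT (N : ℕ) (U : Matrix (Fin N × Fin N) (Fin N × Fin N) ℂ) :
    Matrix (Fin N × Fin N) (Fin N × Fin N) ℂ :=
  ((N : ℂ) ^ 2)⁻¹ • (swapGate N * (ptransp N U * (ptransp N U)ᴴ) * swapGate N)

/-- Purity `X(U) = tr(ρ_R(U)²)` (a real number). -/
def Xpur (N : ℕ) (U : Matrix (Fin N × Fin N) (Fin N × Fin N) ℂ) : ℝ :=
  ((rhoR N U * rhoR N U).trace).re

/-- Purity `Y(U) = tr(ρ_T(U)²)` (a real number). -/
def Ypur (N : ℕ) (U : Matrix (Fin N × Fin N) (Fin N × Fin N) ℂ) : ℝ :=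
  ((rhoT N U * rhoT N U).trace).re

/-- Entangling power `e_p(U)`. -/
def ep (N : ℕ) (U : Matrix (Fin N × Fin N) (Fin N × Fin N) ℂ) : ℝ :=
  ((N : ℝ) ^ 2 / ((N : ℝ) + 1) ^ 2) *
    ((1 - Xpur N U) + (1 - Ypur N U) - ((N : ℝ) ^ 2 - 1) / (N : ℝ) ^ 2)

/-- Gate typicality `g_t(U)`. -/
def gateTyp (N : ℕ) (U : Matrix (Fin N × Fin N) (Fin N × Fin N) ℂ) : ℝ :=
  ((N : ℝ) ^ 2 / ((N : ℝ) ^ 2 - 1)) *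
    (Ypur N U - Xpur N U + ((N : ℝ) ^ 2 - 1) / (N : ℝ) ^ 2)

/-- Mean entangling power over the Haar measure, `ē_p = (N-1)²/(N²+1)`. -/
def epBar (N : ℕ) : ℝ := ((N : ℝ) - 1) ^ 2 / ((N : ℝ) ^ 2 + 1)

/-- `iterGate U W k = U · W_{k-1} · U ⋯ W_0 · U`, i.e. `U^(k+1)` with `k` interlacing
local gates `W_0, …, W_{k-1}`. -/
def iterGate {D : Type*} [Fintype D] [DecidableEq D] (U : Matrix D D ℂ)
    (W : ℕ → Matrix D D ℂ) : ℕ → Matrix D D ℂ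
  | 0 => U
  | k + 1 => U * W k * iterGate U W k


section Commutant

variable {ι : Type*} [Fintype ι] [DecidableEq ι]

lemma permMatrix_mem_unitaryGroup (σ : Equiv.Perm ι) :
    σ.permMatrix ℂ ∈ Matrix.unitaryGroup ι ℂ := by
  rw [Matrix.mem_unitaryGroup_iff, Matrix.star_eq_conjTranspose, Matrix.conjTranspose_permMatrix,
    ← Matrix.permMatrix_mul, inv_mul_cancel, Matrix.permMatrix_one]

lemma diagonal_mem_unitaryGroup {d : ι → ℂ} (hd : ∀ i, d i * star (d i) = 1) :
    Matrix.diagonal d ∈ Matrix.unitaryGroup ι ℂ := by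
  rw [Matrix.mem_unitaryGroup_iff, Matrix.star_eq_conjTranspose, Matrix.diagonal_conjTranspose,
    Matrix.diagonal_mul_diagonal]
  simp only [Pi.star_apply, hd, Matrix.diagonal_one]

/-- A unitary mixing two basis vectors `a` and `b`. -/
lemma exists_unitary_mixing {a b : ι} (hab : a ≠ b) :
    ∃ u ∈ Matrix.unitaryGroup ι ℂ, u a a ≠ 0 ∧ u a b ≠ 0 := by
  set S : Matrix ι ι ℂ := (Equiv.swap a b).permMatrix ℂ
  have hS : S * S = 1 := by
    rw [← Matrix.permMatrix_mul, Equiv.swap_mul_self, Matrix.permMatrix_one]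
  have hS' : Sᴴ = S := by
    rw [Matrix.conjTranspose_permMatrix, Equiv.swap_inv]
  refine ⟨(3 / 5 : ℂ) • 1 + (4 / 5 * Complex.I) • S, ?_, ?_, ?_⟩
  · rw [Matrix.mem_unitaryGroup_iff, Matrix.star_eq_conjTranspose]
    simp only [conjTranspose_add, conjTranspose_smul, hS', conjTranspose_one, mul_add, add_mul,
      smul_mul_smul_comm, hS, one_mul, mul_one]
    rw [← sub_eq_zero]
    ext i j
    simp
    ring_nf
    simp
  · simp [S, PEquiv.toMatrix_apply, Equiv.toPEquiv_apply, hab.symm]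
  · simp [S, PEquiv.toMatrix_apply, Equiv.toPEquiv_apply, hab]

/-- A matrix commuting with all `u ⊗ u` is a combination of the identity and the swap. -/
lemma apply_of_commute_unitary_kronecker {M : Matrix (ι × ι) (ι × ι) ℂ}
    (hM : ∀ u ∈ Matrix.unitaryGroup ι ℂ, (u ⊗ₖ u) * M = M * (u ⊗ₖ u))
    {a b : ι} (hab : a ≠ b) (p q : ι × ι) :
    M p q = M (a, b) (a, b) * (if p = q then 1 else 0) +
      M (a, b) (b, a) * (if p.swap = q then 1 else 0) := by
  have hdiag : ∀ d : ι → ℂ, (∀ i, d i * star (d i) = 1) → ∀ p q : ι × ι,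
      d p.1 * d p.2 * M p q = M p q * (d q.1 * d q.2) := by
    intro d hd p q
    have := congrFun₂ (hM _ (diagonal_mem_unitaryGroup hd)) p q
    rwa [Matrix.diagonal_kronecker_diagonal, Matrix.diagonal_mul, Matrix.mul_diagonal] at this
  have hI : ∀ x i : ι, (if i = x then Complex.I else 1) * star (if i = x then Complex.I else 1)
      = 1 := by
    intro x i; split_ifs <;> simp
  have hI1 : Complex.I ≠ 1 := fun h => by simpa using congrArg Complex.re h
  have hsupp : ∀ p q : ι × ι, p ≠ q → p.swap ≠ q → M p q = 0 := by
    rintro ⟨p1, p2⟩ ⟨q1, q2⟩ h1 h2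
    have k1 := hdiag _ (hI p1) (p1, p2) (q1, q2)
    have k2 := hdiag _ (hI p2) (p1, p2) (q1, q2)
    simp only [Prod.swap_prod_mk, ne_eq, Prod.mk.injEq, not_and] at h1 h2
    by_contra h0
    rw [mul_comm, mul_right_inj' h0] at k1 k2
    have hI2 : Complex.I * Complex.I ≠ 1 := by simp; norm_num
    have hI3 : Complex.I ≠ Complex.I * Complex.I := by
      intro h; simpa using congrArg Complex.re h
    simp only at k1 k2
    have hI0 := Complex.I_ne_zero
    grind
  have hperm : ∀ (σ : Equiv.Perm ι) (p q : ι × ι),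
      M (σ p.1, σ p.2) (σ q.1, σ q.2) = M p q := by
    intro σ p q
    have := congrFun₂ (hM _ (permMatrix_mem_unitaryGroup σ)) p (σ q.1, σ q.2)
    simpa [Matrix.mul_apply, Fintype.sum_prod_type, PEquiv.toMatrix_apply, Equiv.toPEquiv_apply,
      Matrix.kroneckerMap_apply, ite_and] using this
  have htrans : ∀ c d : ι, c ≠ d → ∃ σ : Equiv.Perm ι, σ a = c ∧ σ b = d := by
    intro c d hcd
    refine ⟨Equiv.swap (Equiv.swap a c b) d * Equiv.swap a c, ?_, by simp⟩
    have : Equiv.swap a c b ≠ c := by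
      intro h
      exact hab ((Equiv.swap a c).injective (by simp [h]))
    simp [Equiv.swap_apply_of_ne_of_ne this.symm hcd]
  have hβ : ∀ c d : ι, c ≠ d → M (c, d) (c, d) = M (a, b) (a, b) := by
    intro c d hcd
    obtain ⟨σ, rfl, rfl⟩ := htrans c d hcd
    exact hperm σ (a, b) (a, b)
  have hγ : ∀ c d : ι, c ≠ d → M (c, d) (d, c) = M (a, b) (b, a) := by
    intro c d hcd
    obtain ⟨σ, rfl, rfl⟩ := htrans c d hcd
    exact hperm σ (a, b) (b, a)
  have hα : ∀ c : ι, M (c, c) (c, c) = M (a, b) (a, b) + M (a, b) (b, a) := by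
    intro c
    have hα' : M (a, a) (a, a) = M (a, b) (a, b) + M (a, b) (b, a) := by
      obtain ⟨u, hu, h1, h2⟩ := exists_unitary_mixing hab
      have key := congrFun₂ (hM u hu) (a, a) (a, b)
      rw [Matrix.mul_apply, Matrix.mul_apply] at key
      rw [Finset.sum_eq_add (a, b) (b, a) (by simp [hab])
          (fun x _ hx => by
            rw [hsupp x (a, b) hx.1 (fun h => hx.2 (by rw [← Prod.swap_swap x, h]; rfl)),
              mul_zero]) (by simp) (by simp),
        Finset.sum_eq_single (a, a)
          (fun x _ hx => by
            rw [hsupp (a, a) x hx.symm hx.symm, zero_mul]) (by simp)] at key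
      have hsw : M (b, a) (a, b) = M (a, b) (b, a) := hγ b a hab.symm
      simp only [Matrix.kroneckerMap_apply, hsw] at key
      have h3 : u a a * u a b ≠ 0 := mul_ne_zero h1 h2
      apply mul_left_cancel₀ h3
      linear_combination -key
    rw [← hα', ← hperm (Equiv.swap a c) (a, a) (a, a)]
    simp
  by_cases h1 : p = q
  · subst h1
    by_cases h2 : p.1 = p.2
    · obtain ⟨p1, p2⟩ := p
      simp only at h2
      subst h2
      simp [hα]
    · obtain ⟨p1, p2⟩ := p
      simp only at h2
      simp [hβ p1 p2 h2, h2, Ne.symm h2]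
  · by_cases h2 : p.swap = q
    · subst h2
      obtain ⟨p1, p2⟩ := p
      have h3 : p1 ≠ p2 := by rintro rfl; simp at h1
      simp [hγ p1 p2 h3, h3]
    · simp [h1, h2, hsupp p q h1 h2]

end Commutant

section TensorSwap

variable {ι : Type*}

variable (ι) in
/-- The permutation exchanging the first tensor factors of two copies of `ι × ι`. -/
def swapFst : Equiv.Perm ((ι × ι) × (ι × ι)) where
  toFun x := ((x.2.1, x.1.2), (x.1.1, x.2.2))
  invFun x := ((x.2.1, x.1.2), (x.1.1, x.2.2))
  left_inv _ := rfl
  right_inv _ := rfl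

variable (ι) in
/-- The permutation exchanging the second tensor factors of two copies of `ι × ι`. -/
def swapSnd : Equiv.Perm ((ι × ι) × (ι × ι)) where
  toFun x := ((x.1.1, x.2.2), (x.2.1, x.1.2))
  invFun x := ((x.1.1, x.2.2), (x.2.1, x.1.2))
  left_inv _ := rfl
  right_inv _ := rfl

lemma swapFst_apply (x : (ι × ι) × (ι × ι)) :
    swapFst ι x = ((x.2.1, x.1.2), (x.1.1, x.2.2)) := rfl

lemma swapSnd_apply (x : (ι × ι) × (ι × ι)) :
    swapSnd ι x = ((x.1.1, x.2.2), (x.2.1, x.1.2)) := rfl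

variable [DecidableEq ι]

variable (ι) in
/-- The operator exchanging the first tensor factors of two copies. -/
def swapA : Matrix ((ι × ι) × (ι × ι)) ((ι × ι) × (ι × ι)) ℂ := (swapFst ι).permMatrix ℂ

variable (ι) in
/-- The operator exchanging the second tensor factors of two copies. -/
def swapB : Matrix ((ι × ι) × (ι × ι)) ((ι × ι) × (ι × ι)) ℂ := (swapSnd ι).permMatrix ℂ

lemma swapA_conjTranspose : (swapA ι)ᴴ = swapA ι := by
  rw [swapA, Matrix.conjTranspose_permMatrix]; rfl

lemma swapB_conjTranspose : (swapB ι)ᴴ = swapB ι := by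
  rw [swapB, Matrix.conjTranspose_permMatrix]; rfl

variable (ι) in
/-- The difference of the two partial swaps. -/
def swapDiff : Matrix ((ι × ι) × (ι × ι)) ((ι × ι) × (ι × ι)) ℂ := swapA ι - swapB ι

lemma swapDiff_conjTranspose : (swapDiff ι)ᴴ = swapDiff ι := by
  rw [swapDiff, Matrix.conjTranspose_sub, swapA_conjTranspose, swapB_conjTranspose]

variable [Fintype ι]

lemma swapA_mul_apply (M : Matrix ((ι × ι) × (ι × ι)) ((ι × ι) × (ι × ι)) ℂ) (x y) :
    (swapA ι * M) x y = M (swapFst ι x) y := by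
  rw [swapA, PEquiv.toMatrix_toPEquiv_mul]; rfl

lemma swapB_mul_apply (M : Matrix ((ι × ι) × (ι × ι)) ((ι × ι) × (ι × ι)) ℂ) (x y) :
    (swapB ι * M) x y = M (swapSnd ι x) y := by
  rw [swapB, PEquiv.toMatrix_toPEquiv_mul]; rfl

lemma mul_swapA_apply (M : Matrix ((ι × ι) × (ι × ι)) ((ι × ι) × (ι × ι)) ℂ) (x y) :
    (M * swapA ι) x y = M x (swapFst ι y) := by
  rw [swapA, PEquiv.mul_toMatrix_toPEquiv]; rfl

lemma mul_swapB_apply (M : Matrix ((ι × ι) × (ι × ι)) ((ι × ι) × (ι × ι)) ℂ) (x y) :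
    (M * swapB ι) x y = M x (swapSnd ι y) := by
  rw [swapB, PEquiv.mul_toMatrix_toPEquiv]; rfl

lemma swapA_mul_self : swapA ι * swapA ι = 1 := by
  rw [swapA, ← Matrix.permMatrix_mul, ← Matrix.permMatrix_one]; rfl

lemma swapB_mul_self : swapB ι * swapB ι = 1 := by
  rw [swapB, ← Matrix.permMatrix_mul, ← Matrix.permMatrix_one]; rfl

lemma swapB_mul_swapA : swapB ι * swapA ι = swapA ι * swapB ι := by
  rw [swapA, swapB, ← Matrix.permMatrix_mul, ← Matrix.permMatrix_mul]; rfl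

lemma swapAB_mul_kronecker (V : Matrix (ι × ι) (ι × ι) ℂ) :
    swapA ι * swapB ι * (V ⊗ₖ V) = (V ⊗ₖ V) * (swapA ι * swapB ι) := by
  ext x y
  rw [← Matrix.mul_assoc (V ⊗ₖ V), mul_swapB_apply, mul_swapA_apply, Matrix.mul_assoc,
    swapA_mul_apply, swapB_mul_apply]
  simp only [swapFst_apply, swapSnd_apply, Matrix.kroneckerMap_apply]
  ring

lemma swapA_mul_local (u v : Matrix ι ι ℂ) :
    swapA ι * ((u ⊗ₖ v) ⊗ₖ (u ⊗ₖ v)) = ((u ⊗ₖ v) ⊗ₖ (u ⊗ₖ v)) * swapA ι := by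
  ext x y
  rw [mul_swapA_apply, swapA_mul_apply]
  simp only [swapFst_apply, Matrix.kroneckerMap_apply]
  ring

lemma swapB_mul_local (u v : Matrix ι ι ℂ) :
    swapB ι * ((u ⊗ₖ v) ⊗ₖ (u ⊗ₖ v)) = ((u ⊗ₖ v) ⊗ₖ (u ⊗ₖ v)) * swapB ι := by
  ext x y
  rw [mul_swapB_apply, swapB_mul_apply]
  simp only [swapSnd_apply, Matrix.kroneckerMap_apply]
  ring

lemma trace_swapA : (swapA ι).trace = (Fintype.card ι : ℂ) ^ 3 := by
  simp only [Matrix.trace, Matrix.diag, swapA, PEquiv.toMatrix_apply, Equiv.toPEquiv_apply,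
    swapFst_apply, Fintype.sum_prod_type]
  simp [Prod.ext_iff, eq_comm]
  ring

lemma trace_swapB : (swapB ι).trace = (Fintype.card ι : ℂ) ^ 3 := by
  simp only [Matrix.trace, Matrix.diag, swapB, PEquiv.toMatrix_apply, Equiv.toPEquiv_apply,
    swapSnd_apply, Fintype.sum_prod_type]
  simp [Prod.ext_iff, eq_comm]
  ring

lemma trace_swapAB : (swapA ι * swapB ι).trace = (Fintype.card ι : ℂ) ^ 2 := by
  simp only [Matrix.trace, Matrix.diag, mul_swapB_apply, swapA, PEquiv.toMatrix_apply,
    Equiv.toPEquiv_apply, swapFst_apply, swapSnd_apply, Fintype.sum_prod_type]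
  simp [Prod.ext_iff, ite_and, eq_comm]
  ring

lemma swapDiff_mul_swapAB : swapDiff ι * (swapA ι * swapB ι) = -swapDiff ι := by
  have h : swapB ι * (swapA ι * swapB ι) = swapA ι := by
    rw [← swapB_mul_swapA, ← Matrix.mul_assoc, swapB_mul_self, Matrix.one_mul]
  rw [swapDiff, sub_mul, h, ← Matrix.mul_assoc, swapA_mul_self, Matrix.one_mul, neg_sub]

lemma swapAB_mul_swapDiff : swapA ι * swapB ι * swapDiff ι = -swapDiff ι := by
  rw [← swapDiff_mul_swapAB]
  simp only [swapDiff, mul_sub, sub_mul, ← Matrix.mul_assoc]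
  simp only [swapA_mul_self, swapB_mul_swapA]
  simp only [Matrix.mul_assoc, swapB_mul_swapA, swapB_mul_self]
  simp only [← Matrix.mul_assoc, swapA_mul_self]

lemma swapDiff_mul_local (u v : Matrix ι ι ℂ) :
    swapDiff ι * ((u ⊗ₖ v) ⊗ₖ (u ⊗ₖ v)) = ((u ⊗ₖ v) ⊗ₖ (u ⊗ₖ v)) * swapDiff ι := by
  rw [swapDiff, sub_mul, mul_sub, swapA_mul_local, swapB_mul_local]

lemma trace_swapDiff : (swapDiff ι).trace = 0 := by
  rw [swapDiff, Matrix.trace_sub, trace_swapA, trace_swapB, sub_self]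

lemma trace_swapDiff_mul_swapDiff : (swapDiff ι * swapDiff ι).trace =
    2 * (Fintype.card ι : ℂ) ^ 2 * ((Fintype.card ι : ℂ) ^ 2 - 1) := by
  simp only [swapDiff, mul_sub, sub_mul, swapA_mul_self, swapB_mul_self, swapB_mul_swapA,
    Matrix.trace_sub, trace_swapAB, Matrix.trace_one, Fintype.card_prod]
  push_cast
  ring

/-- A matrix commuting with two copies of every local unitary is a combination of the partial
swaps. -/
lemma exists_eq_combination_of_commute_local [Nontrivial ι]
    {M : Matrix ((ι × ι) × (ι × ι)) ((ι × ι) × (ι × ι)) ℂ}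
    (hM : ∀ u ∈ Matrix.unitaryGroup ι ℂ, ∀ v ∈ Matrix.unitaryGroup ι ℂ,
      ((u ⊗ₖ v) ⊗ₖ (u ⊗ₖ v)) * M = M * ((u ⊗ₖ v) ⊗ₖ (u ⊗ₖ v))) :
    ∃ a b c d : ℂ, M = a • (1 : Matrix _ _ ℂ) + b • swapA ι + c • swapB ι +
      d • (swapA ι * swapB ι) := by
  obtain ⟨i, j, hij⟩ := exists_pair_ne ι
  have hfst : ∀ r s p q : ι × ι,
      M ((p.1, r.1), (p.2, r.2)) ((q.1, s.1), (q.2, s.2)) =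
        M ((i, r.1), (j, r.2)) ((i, s.1), (j, s.2)) * (if p = q then 1 else 0) +
        M ((i, r.1), (j, r.2)) ((j, s.1), (i, s.2)) * (if p.swap = q then 1 else 0) := by
    intro r s p q
    refine apply_of_commute_unitary_kronecker
      (M := Matrix.of fun p q => M ((p.1, r.1), (p.2, r.2)) ((q.1, s.1), (q.2, s.2))) ?_ hij p q
    intro u hu
    ext p q
    have := congrFun₂ (hM u hu 1 (one_mem _)) ((p.1, r.1), (p.2, r.2)) ((q.1, s.1), (q.2, s.2))
    simpa [Matrix.mul_apply, Fintype.sum_prod_type, Matrix.kroneckerMap_apply, Matrix.one_apply]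
      using this
  have hsnd : ∀ (k l : ι) (r s : ι × ι),
      M ((i, r.1), (j, r.2)) ((k, s.1), (l, s.2)) =
        M ((i, i), (j, j)) ((k, i), (l, j)) * (if r = s then 1 else 0) +
        M ((i, i), (j, j)) ((k, j), (l, i)) * (if r.swap = s then 1 else 0) := by
    intro k l r s
    refine apply_of_commute_unitary_kronecker
      (M := Matrix.of fun r s => M ((i, r.1), (j, r.2)) ((k, s.1), (l, s.2))) ?_ hij r s
    intro v hv
    ext r s
    have := congrFun₂ (hM 1 (one_mem _) v hv) ((i, r.1), (j, r.2)) ((k, s.1), (l, s.2))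
    simpa [Matrix.mul_apply, Fintype.sum_prod_type, Matrix.kroneckerMap_apply, Matrix.one_apply]
      using this
  refine ⟨M ((i, i), (j, j)) ((i, i), (j, j)), M ((i, i), (j, j)) ((j, i), (i, j)),
    M ((i, i), (j, j)) ((i, j), (j, i)), M ((i, i), (j, j)) ((j, j), (i, i)), ?_⟩
  ext ⟨⟨p1, r1⟩, ⟨p2, r2⟩⟩ ⟨⟨q1, s1⟩, ⟨q2, s2⟩⟩
  have h := hfst (r1, r2) (s1, s2) (p1, p2) (q1, q2)
  rw [hsnd i j, hsnd j i] at h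
  simp only [Matrix.add_apply, Matrix.smul_apply, smul_eq_mul, mul_swapB_apply]
  refine h.trans ?_
  simp only [swapA, swapB, PEquiv.toMatrix_apply, Equiv.toPEquiv_apply, swapFst_apply,
    swapSnd_apply, Matrix.one_apply, Prod.mk.injEq, Prod.swap_prod_mk, Option.mem_some_iff]
  clear h hfst hsnd hM
  grind (splits := 30)

/-- Orthogonal projection onto the commutant of the local gates, in the sector that is
antisymmetric under exchanging the two copies. -/
lemma eq_smul_swapDiff_of_commute_local [Nontrivial ι]
    {M : Matrix ((ι × ι) × (ι × ι)) ((ι × ι) × (ι × ι)) ℂ}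
    (hM : ∀ u ∈ Matrix.unitaryGroup ι ℂ, ∀ v ∈ Matrix.unitaryGroup ι ℂ,
      ((u ⊗ₖ v) ⊗ₖ (u ⊗ₖ v)) * M = M * ((u ⊗ₖ v) ⊗ₖ (u ⊗ₖ v)))
    (hanti : M * (swapA ι * swapB ι) = -M) (htr : M.trace = 0) :
    M = ((M * swapDiff ι).trace / (swapDiff ι * swapDiff ι).trace) • swapDiff ι := by
  obtain ⟨a, b, c, d, h⟩ := exists_eq_combination_of_commute_local hM
  have hn : (1 : ℝ) < Fintype.card ι := by exact_mod_cast Fintype.one_lt_card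
  have hne : (Fintype.card ι : ℂ) ^ 2 * ((Fintype.card ι : ℂ) ^ 2 - 1) ≠ 0 := by
    have : (Fintype.card ι : ℝ) ^ 2 * ((Fintype.card ι : ℝ) ^ 2 - 1) ≠ 0 := by
      have : (0 : ℝ) < (Fintype.card ι : ℝ) ^ 2 - 1 := by nlinarith
      positivity
    exact_mod_cast this
  have hmul : M * (swapA ι * swapB ι) =
      a • (swapA ι * swapB ι) + b • swapB ι + c • swapA ι + d • (1 : Matrix _ _ ℂ) := by
    have h1 : swapB ι * (swapA ι * swapB ι) = swapA ι := by
      rw [← swapB_mul_swapA, ← Matrix.mul_assoc, swapB_mul_self, Matrix.one_mul]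
    have h2 : swapA ι * (swapA ι * swapB ι) = swapB ι := by
      rw [← Matrix.mul_assoc, swapA_mul_self, Matrix.one_mul]
    rw [h]
    simp only [add_mul, Matrix.smul_mul, one_mul, h1, h2, Matrix.mul_assoc,
      swapA_mul_self]
  have h2M : (2 : ℂ) • M = (a - d) • (1 - swapA ι * swapB ι) + (b - c) • swapDiff ι := by
    have : (2 : ℂ) • M = M - M * (swapA ι * swapB ι) := by rw [hanti, sub_neg_eq_add, two_smul]
    rw [this, hmul, h, swapDiff]
    module
  have had : a - d = 0 := by
    have := congrArg Matrix.trace h2M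
    rw [Matrix.trace_smul, htr, Matrix.trace_add, Matrix.trace_smul, Matrix.trace_smul,
      trace_swapDiff, Matrix.trace_sub, trace_swapAB, Matrix.trace_one] at this
    simp only [Fintype.card_prod, smul_eq_mul, mul_zero, add_zero] at this
    push_cast at this
    refine (mul_eq_zero.mp ?_).resolve_right hne
    rw [this]
    ring
  have hM' : M = ((b - c) / 2) • swapDiff ι := by
    rw [had, zero_smul, zero_add] at h2M
    rw [div_eq_inv_mul, mul_smul, ← h2M, smul_smul]
    norm_num
  have hD : (swapDiff ι * swapDiff ι).trace ≠ 0 := by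
    rw [trace_swapDiff_mul_swapDiff, mul_assoc]
    exact mul_ne_zero two_ne_zero hne
  conv_lhs => rw [hM']
  rw [hM', Matrix.smul_mul, Matrix.trace_smul, smul_eq_mul, mul_div_cancel_right₀ _ hD]

end TensorSwap

section GateTypicality

/-- The overlap of `swapDiff` with its conjugation by two copies of `V`. -/
def swapDiffOverlap (N : ℕ) (V : Matrix (Fin N × Fin N) (Fin N × Fin N) ℂ) : ℂ :=
  ((V ⊗ₖ V) * swapDiff (Fin N) * (V ⊗ₖ V)ᴴ * swapDiff (Fin N)).trace

variable {N : ℕ}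

lemma star_swapDiffOverlap (V : Matrix (Fin N × Fin N) (Fin N × Fin N) ℂ) :
    star (swapDiffOverlap N V) = swapDiffOverlap N V := by
  rw [swapDiffOverlap, ← Matrix.trace_conjTranspose]
  simp only [Matrix.conjTranspose_mul, Matrix.conjTranspose_conjTranspose, swapDiff_conjTranspose]
  rw [Matrix.trace_mul_comm]
  simp only [Matrix.mul_assoc]

lemma trace_mul_conjTranspose_sq {m n : Type*} [Fintype m] [Fintype n] (A : Matrix m n ℂ) :
    (A * Aᴴ * (A * Aᴴ)).trace =
      ∑ z : (m × n) × (m × n), A z.1.1 z.1.2 * star (A z.2.1 z.1.2) *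
        (A z.2.1 z.2.2 * star (A z.1.1 z.2.2)) := by
  simp only [Fintype.sum_prod_type, Matrix.trace, Matrix.diag, Matrix.mul_apply,
    Matrix.conjTranspose_apply, Finset.sum_mul_sum]
  exact Finset.sum_congr rfl fun _ _ => Finset.sum_comm

lemma trace_kronecker_mul_swapA (V : Matrix (Fin N × Fin N) (Fin N × Fin N) ℂ) :
    ((V ⊗ₖ V) * swapA (Fin N) * (V ⊗ₖ V)ᴴ * swapA (Fin N)).trace =
      ∑ z : ((Fin N × Fin N) × (Fin N × Fin N)) × ((Fin N × Fin N) × (Fin N × Fin N)),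
        (V ⊗ₖ V) z.1 (swapFst _ z.2) * star ((V ⊗ₖ V) (swapFst _ z.1) z.2) := by
  rw [Fintype.sum_prod_type, Matrix.trace_mul_comm]
  simp only [Matrix.trace, Matrix.diag, swapA_mul_apply]
  rw [← Equiv.sum_comp (swapFst _)]
  refine Finset.sum_congr rfl fun x _ => ?_
  rw [Matrix.mul_apply]
  simp only [mul_swapA_apply, Matrix.conjTranspose_apply]
  rfl

lemma trace_kronecker_mul_swapB (V : Matrix (Fin N × Fin N) (Fin N × Fin N) ℂ) :
    ((V ⊗ₖ V) * swapB (Fin N) * (V ⊗ₖ V)ᴴ * swapA (Fin N)).trace =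
      ∑ z : ((Fin N × Fin N) × (Fin N × Fin N)) × ((Fin N × Fin N) × (Fin N × Fin N)),
        (V ⊗ₖ V) z.1 (swapSnd _ z.2) * star ((V ⊗ₖ V) (swapFst _ z.1) z.2) := by
  rw [Fintype.sum_prod_type, Matrix.trace_mul_comm]
  simp only [Matrix.trace, Matrix.diag, swapA_mul_apply]
  rw [← Equiv.sum_comp (swapFst _)]
  refine Finset.sum_congr rfl fun x _ => ?_
  rw [Matrix.mul_apply]
  simp only [mul_swapB_apply, Matrix.conjTranspose_apply]
  rfl

lemma trace_rhoR_sq (V : Matrix (Fin N × Fin N) (Fin N × Fin N) ℂ) :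
    (rhoR N V * rhoR N V).trace = ((N : ℂ) ^ 4)⁻¹ *
      ((V ⊗ₖ V) * swapA (Fin N) * (V ⊗ₖ V)ᴴ * swapA (Fin N)).trace := by
  rw [rhoR, smul_mul_smul_comm, Matrix.trace_smul, smul_eq_mul]
  congr 1
  · rw [← mul_inv]; ring
  rw [trace_mul_conjTranspose_sq, trace_kronecker_mul_swapA]
  refine Fintype.sum_equiv
    ⟨fun z => (((z.1.1.1, z.1.2.1), (z.2.1.1, z.2.2.1)), ((z.2.1.2, z.1.2.2), (z.1.1.2, z.2.2.2))),
      fun z => (((z.1.1.1, z.2.2.1), (z.1.1.2, z.2.1.2)), ((z.1.2.1, z.2.1.1), (z.1.2.2, z.2.2.2))),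
      fun _ => rfl, fun _ => rfl⟩ _ _ fun z => ?_
  simp only [reshuffle, Matrix.of_apply, Matrix.kroneckerMap_apply, Equiv.coe_fn_mk, swapFst_apply,
    star_mul']
  ring

lemma trace_rhoT_sq (V : Matrix (Fin N × Fin N) (Fin N × Fin N) ℂ) :
    (rhoT N V * rhoT N V).trace = ((N : ℂ) ^ 4)⁻¹ *
      ((V ⊗ₖ V) * swapB (Fin N) * (V ⊗ₖ V)ᴴ * swapA (Fin N)).trace := by
  have hS : swapGate N * swapGate N = 1 := by
    ext ⟨i, j⟩ ⟨k, l⟩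
    simp [swapGate, Matrix.mul_apply, Fintype.sum_prod_type, Matrix.one_apply, ite_and]
  rw [rhoT, smul_mul_smul_comm, Matrix.trace_smul, smul_eq_mul]
  congr 1
  · rw [← mul_inv]; ring
  have hconj : ∀ M : Matrix (Fin N × Fin N) (Fin N × Fin N) ℂ,
      (swapGate N * M * swapGate N * (swapGate N * M * swapGate N)).trace = (M * M).trace := by
    intro M
    have : swapGate N * M * swapGate N * (swapGate N * M * swapGate N) =
        swapGate N * (M * (swapGate N * swapGate N) * M) * swapGate N := by
      simp only [Matrix.mul_assoc]
    rw [this, hS, Matrix.mul_one, Matrix.trace_mul_comm, ← Matrix.mul_assoc, hS, Matrix.one_mul]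
  rw [hconj, trace_mul_conjTranspose_sq, trace_kronecker_mul_swapB]
  refine Fintype.sum_equiv
    ⟨fun z => (((z.1.2.1, z.1.1.2), (z.2.2.1, z.2.1.2)), ((z.1.1.1, z.2.2.2), (z.2.1.1, z.1.2.2))),
      fun z => (((z.2.1.1, z.1.1.2), (z.1.1.1, z.2.2.2)), ((z.2.2.1, z.1.2.2), (z.1.2.1, z.2.1.2))),
      fun _ => rfl, fun _ => rfl⟩ _ _ fun z => ?_
  simp only [ptransp, Matrix.of_apply, Matrix.kroneckerMap_apply, Equiv.coe_fn_mk, swapFst_apply,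
    swapSnd_apply, star_mul']
  ring

lemma one_sub_gateTyp (hN : 2 ≤ N) (V : Matrix (Fin N × Fin N) (Fin N × Fin N) ℂ) :
    ((1 - gateTyp N V : ℝ) : ℂ) =
      swapDiffOverlap N V / (swapDiff (Fin N) * swapDiff (Fin N)).trace := by
  set T := (V ⊗ₖ V) * swapDiff (Fin N) * (V ⊗ₖ V)ᴴ with hT
  have hanti : swapA (Fin N) * swapB (Fin N) * T = -T := by
    rw [hT, ← Matrix.mul_assoc, ← Matrix.mul_assoc, swapAB_mul_kronecker,
      Matrix.mul_assoc (V ⊗ₖ V), swapAB_mul_swapDiff, mul_neg, neg_mul]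
  clear_value T
  have hB : (T * swapB (Fin N)).trace = -(T * swapA (Fin N)).trace := by
    rw [← Matrix.trace_neg, ← neg_mul, ← hanti, Matrix.trace_mul_comm _ (swapA (Fin N)),
      ← Matrix.mul_assoc, ← Matrix.mul_assoc, swapA_mul_self, Matrix.one_mul,
      Matrix.trace_mul_comm]
  have hK : swapDiffOverlap N V = 2 * (T * swapA (Fin N)).trace := by
    rw [swapDiffOverlap, ← hT]
    conv_lhs => rw [swapDiff, mul_sub, Matrix.trace_sub, hB]
    ring
  have hre : ((swapDiffOverlap N V).re : ℂ) = swapDiffOverlap N V :=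
    Complex.conj_eq_iff_re.mp (star_swapDiffOverlap V)
  have hXY : Xpur N V - Ypur N V = ((N : ℝ) ^ 4)⁻¹ * ((swapDiffOverlap N V).re / 2) := by
    rw [Xpur, Ypur, trace_rhoR_sq, trace_rhoT_sq, ← Complex.sub_re, ← mul_sub,
      ← Matrix.trace_sub, ← sub_mul, ← sub_mul, ← mul_sub, ← swapDiff, ← hT]
    have : (T * swapA (Fin N)).trace = ((swapDiffOverlap N V).re / 2 : ℝ) := by
      push_cast
      rw [hre, hK]
      ring
    rw [this, ← Complex.ofReal_natCast, ← Complex.ofReal_pow, ← Complex.ofReal_inv,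
      ← Complex.ofReal_mul, Complex.ofReal_re]
  have hN' : (2 : ℝ) ≤ N := by exact_mod_cast hN
  have hN1 : (N : ℝ) ^ 2 - 1 ≠ 0 := by nlinarith
  have hN0 : (N : ℝ) ≠ 0 := by positivity
  rw [trace_swapDiff_mul_swapDiff, Fintype.card_fin, ← hre]
  norm_cast
  push_cast
  have : 1 - gateTyp N V = (N : ℝ) ^ 2 / ((N : ℝ) ^ 2 - 1) * (Xpur N V - Ypur N V) := by
    rw [gateTyp]
    field_simp
    ring
  rw [this, hXY]
  field_simp

end GateTypicality

section Twirl

instance {m n : Type*} [Finite m] [Finite n] : SecondCountableTopology (Matrix m n ℂ) :=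
  inferInstanceAs (SecondCountableTopology (m → n → ℂ))

instance {m : Type*} [Fintype m] [DecidableEq m] : CompactSpace (Matrix.unitaryGroup m ℂ) := by
  have hK : IsCompact (Set.univ.pi fun _ : m => Set.univ.pi fun _ : m =>
      Metric.closedBall (0 : ℂ) 1) :=
    isCompact_univ_pi fun _ => isCompact_univ_pi fun _ => isCompact_closedBall _ _
  refine isCompact_iff_compactSpace.mp
    (IsCompact.of_isClosed_subset (X := Matrix m m ℂ) hK isClosed_unitary ?_)
  intro A hA i _ j _
  rw [mem_closedBall_zero_iff]
  exact entry_norm_bound_of_unitary hA i j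

instance {m : Type*} [Fintype m] [DecidableEq m] :
    SecondCountableTopology (Matrix.unitaryGroup m ℂ) :=
  TopologicalSpace.Subtype.secondCountableTopology _

instance {m : Type*} [Fintype m] [DecidableEq m] : BorelSpace (Matrix.unitaryGroup m ℂ) :=
  Subtype.borelSpace _

lemma integrable_of_continuous {X E : Type*} [TopologicalSpace X] [CompactSpace X]
    [MeasurableSpace X] [OpensMeasurableSpace X] [NormedAddCommGroup E] {μ : Measure X}
    [IsFiniteMeasure μ] {f : X → E} (hf : Continuous f) : Integrable f μ :=
  hf.integrable_of_hasCompactSupport (HasCompactSupport.of_compactSpace f)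

lemma map_integral_matrix {X m n : Type*} [TopologicalSpace X] [CompactSpace X]
    [MeasurableSpace X] [OpensMeasurableSpace X] [Fintype m] [Fintype n]
    {μ : Measure X} [IsFiniteMeasure μ] {f : X → Matrix m n ℂ} (hf : Continuous f)
    (φ : Matrix m n ℂ →ₗ[ℂ] ℂ) :
    φ (Matrix.of fun i j => ∫ x, f x i j ∂μ) = ∫ x, φ (f x) ∂μ := by
  classical
  have h : ∀ A : Matrix m n ℂ, φ A = ∑ i, ∑ j, A i j * φ (Matrix.single i j 1) := by
    intro A
    conv_lhs => rw [Matrix.matrix_eq_sum_single A]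
    simp only [map_sum]
    refine Finset.sum_congr rfl fun i _ => Finset.sum_congr rfl fun j _ => ?_
    rw [← smul_eq_mul, ← map_smul, Matrix.smul_single, smul_eq_mul, mul_one]
  have hint : ∀ i j, Integrable (fun x => f x i j * φ (Matrix.single i j 1)) μ := fun i j =>
    integrable_of_continuous ((hf.matrix_elem i j).mul continuous_const)
  rw [h, funext fun x => h (f x)]
  rw [integral_finsetSum _ fun i _ => integrable_finsetSum _ fun j _ => hint i j]
  refine Finset.sum_congr rfl fun i _ => ?_
  rw [integral_finsetSum _ fun j _ => hint i j]
  refine Finset.sum_congr rfl fun j _ => ?_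
  rw [integral_mul_const, Matrix.of_apply]

lemma Continuous.matrix_kroneckerMap_mul {X l m n p : Type*} [TopologicalSpace X]
    {A : X → Matrix l m ℂ} {B : X → Matrix n p ℂ} (hA : Continuous A) (hB : Continuous B) :
    Continuous fun x => A x ⊗ₖ B x :=
  continuous_matrix fun i j => (hA.matrix_elem i.1 j.1).mul (hB.matrix_elem i.2 j.2)

variable {ι : Type*} [Fintype ι] [DecidableEq ι]

/-- Two copies of the local gate `g.1 ⊗ g.2`. -/
def localPair (g : Matrix.unitaryGroup ι ℂ × Matrix.unitaryGroup ι ℂ) :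
    Matrix ((ι × ι) × (ι × ι)) ((ι × ι) × (ι × ι)) ℂ :=
  ((g.1 : Matrix ι ι ℂ) ⊗ₖ (g.2 : Matrix ι ι ℂ)) ⊗ₖ ((g.1 : Matrix ι ι ℂ) ⊗ₖ (g.2 : Matrix ι ι ℂ))

lemma continuous_localGate :
    Continuous fun g : Matrix.unitaryGroup ι ℂ × Matrix.unitaryGroup ι ℂ =>
      (g.1 : Matrix ι ι ℂ) ⊗ₖ (g.2 : Matrix ι ι ℂ) :=
  (continuous_subtype_val.comp continuous_fst).matrix_kroneckerMap_mul
    (continuous_subtype_val.comp continuous_snd)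

lemma continuous_localPair : Continuous (localPair (ι := ι)) :=
  continuous_localGate.matrix_kroneckerMap_mul continuous_localGate

lemma localPair_mul (g h : Matrix.unitaryGroup ι ℂ × Matrix.unitaryGroup ι ℂ) :
    localPair (g * h) = localPair g * localPair h := by
  simp only [localPair, Prod.fst_mul, Prod.snd_mul, Submonoid.coe_mul, Matrix.mul_kronecker_mul]

lemma localPair_mem (g : Matrix.unitaryGroup ι ℂ × Matrix.unitaryGroup ι ℂ) :
    localPair g ∈ Matrix.unitaryGroup ((ι × ι) × (ι × ι)) ℂ :=
  Matrix.kronecker_mem_unitary (Matrix.kronecker_mem_unitary g.1.2 g.2.2)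
    (Matrix.kronecker_mem_unitary g.1.2 g.2.2)

lemma localPair_conjTranspose_mul_self (g : Matrix.unitaryGroup ι ℂ × Matrix.unitaryGroup ι ℂ) :
    (localPair g)ᴴ * localPair g = 1 :=
  Matrix.mem_unitaryGroup_iff'.mp (localPair_mem g)

/-- The average of `Z` conjugated by two copies of a local gate. -/
def localTwirl (ν : Measure (Matrix.unitaryGroup ι ℂ × Matrix.unitaryGroup ι ℂ))
    (Z : Matrix ((ι × ι) × (ι × ι)) ((ι × ι) × (ι × ι)) ℂ) :
    Matrix ((ι × ι) × (ι × ι)) ((ι × ι) × (ι × ι)) ℂ :=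
  Matrix.of fun p q => ∫ g, (localPair g * Z * (localPair g)ᴴ) p q ∂ν

variable (ν : Measure (Matrix.unitaryGroup ι ℂ × Matrix.unitaryGroup ι ℂ))
  [IsFiniteMeasure ν] (Z : Matrix ((ι × ι) × (ι × ι)) ((ι × ι) × (ι × ι)) ℂ)

lemma map_localTwirl
    (φ : Matrix ((ι × ι) × (ι × ι)) ((ι × ι) × (ι × ι)) ℂ →ₗ[ℂ] ℂ) :
    φ (localTwirl ν Z) = ∫ g, φ (localPair g * Z * (localPair g)ᴴ) ∂ν :=
  map_integral_matrix (f := fun g => localPair g * Z * (localPair g)ᴴ)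
    ((continuous_localPair.matrix_mul continuous_const).matrix_mul
      continuous_localPair.matrix_conjTranspose) φ

lemma localPair_mul_localTwirl [ν.IsMulLeftInvariant]
    (h : Matrix.unitaryGroup ι ℂ × Matrix.unitaryGroup ι ℂ) :
    localPair h * localTwirl ν Z = localTwirl ν Z * localPair h := by
  have hinv : localPair h * localTwirl ν Z * (localPair h)ᴴ = localTwirl ν Z := by
    ext p q
    have := map_localTwirl ν Z (Matrix.entryLinearMap ℂ ℂ p q ∘ₗ
      LinearMap.mulLeftRight ℂ (localPair h, (localPair h)ᴴ))
    simp only [LinearMap.comp_apply, LinearMap.mulLeftRight_apply,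
      Matrix.entryLinearMap_apply] at this
    rw [this, localTwirl, Matrix.of_apply,
      ← integral_mul_left_eq_self (fun g => (localPair g * Z * (localPair g)ᴴ) p q) h]
    simp only [localPair_mul, Matrix.conjTranspose_mul, Matrix.mul_assoc]
  conv_rhs => rw [← hinv]
  rw [Matrix.mul_assoc _ _ (localPair h), localPair_conjTranspose_mul_self, Matrix.mul_one]

lemma trace_localTwirl_mul [IsProbabilityMeasure ν]
    {Y : Matrix ((ι × ι) × (ι × ι)) ((ι × ι) × (ι × ι)) ℂ}
    (hY : ∀ g, Y * localPair g = localPair g * Y) :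
    (localTwirl ν Z * Y).trace = (Z * Y).trace := by
  have := map_localTwirl ν Z (Matrix.traceLinearMap _ ℂ ℂ ∘ₗ LinearMap.mulRight ℂ Y)
  simp only [LinearMap.comp_apply, LinearMap.mulRight_apply, Matrix.traceLinearMap_apply] at this
  have hconst : ∀ g, (localPair g * Z * (localPair g)ᴴ * Y).trace = (Z * Y).trace := by
    intro g
    rw [Matrix.trace_mul_comm, ← Matrix.mul_assoc, ← Matrix.mul_assoc, hY, Matrix.trace_mul_comm,
      Matrix.mul_assoc, ← Matrix.mul_assoc, localPair_conjTranspose_mul_self, Matrix.one_mul,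
      Matrix.trace_mul_comm]
  rw [this]
  simp [hconst]

lemma localTwirl_eq_smul_swapDiff [Nontrivial ι] [IsProbabilityMeasure ν]
    [ν.IsMulLeftInvariant]
    (hanti : Z * (swapA ι * swapB ι) = -Z) (htr : Z.trace = 0) :
    localTwirl ν Z =
      ((Z * swapDiff ι).trace / (swapDiff ι * swapDiff ι).trace) • swapDiff ι := by
  rw [← trace_localTwirl_mul ν Z (fun g => swapDiff_mul_local _ _)]
  refine eq_smul_swapDiff_of_commute_local (fun u hu v hv =>
    localPair_mul_localTwirl ν Z (⟨u, hu⟩, ⟨v, hv⟩)) ?_ ?_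
  · ext p q
    have := map_localTwirl ν Z (Matrix.entryLinearMap ℂ ℂ p q ∘ₗ
      LinearMap.mulRight ℂ (swapA ι * swapB ι))
    simp only [LinearMap.comp_apply, LinearMap.mulRight_apply,
      Matrix.entryLinearMap_apply] at this
    rw [this, Matrix.neg_apply, localTwirl, Matrix.of_apply, ← integral_neg]
    refine integral_congr_ae (.of_forall fun g => ?_)
    have hc : (localPair g)ᴴ * (swapA ι * swapB ι) = (swapA ι * swapB ι) * (localPair g)ᴴ := by
      rw [localPair, Matrix.conjTranspose_kronecker, swapAB_mul_kronecker]
    simp only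
    rw [Matrix.mul_assoc, hc, ← Matrix.mul_assoc, Matrix.mul_assoc (localPair g), hanti, mul_neg,
      neg_mul, Matrix.neg_apply]
  · have := trace_localTwirl_mul ν Z (Y := 1) (fun g => by rw [Matrix.one_mul, Matrix.mul_one])
    rwa [Matrix.mul_one, Matrix.mul_one, htr] at this

end Twirl

section IteratedGate

variable {N : ℕ}

lemma integral_swapDiffOverlap (hN : 2 ≤ N)
    (ν : Measure (Matrix.unitaryGroup (Fin N) ℂ × Matrix.unitaryGroup (Fin N) ℂ))
    [IsProbabilityMeasure ν] [ν.IsMulLeftInvariant]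
    (U : Matrix (Fin N × Fin N) (Fin N × Fin N) ℂ) {V : Matrix (Fin N × Fin N) (Fin N × Fin N) ℂ}
    (hV : V ∈ Matrix.unitaryGroup (Fin N × Fin N) ℂ) :
    ∫ g, swapDiffOverlap N (U * ((g.1 : Matrix (Fin N) (Fin N) ℂ) ⊗ₖ
        (g.2 : Matrix (Fin N) (Fin N) ℂ)) * V) ∂ν =
      swapDiffOverlap N U * swapDiffOverlap N V / (swapDiff (Fin N) * swapDiff (Fin N)).trace := by
  have : Nontrivial (Fin N) := Fin.nontrivial_iff_two_le.mpr hN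
  have hVV : (V ⊗ₖ V)ᴴ * (V ⊗ₖ V) = 1 :=
    Matrix.mem_unitaryGroup_iff'.mp (Matrix.kronecker_mem_unitary hV hV)
  have hanti : (V ⊗ₖ V) * swapDiff (Fin N) * (V ⊗ₖ V)ᴴ * (swapA (Fin N) * swapB (Fin N)) =
      -((V ⊗ₖ V) * swapDiff (Fin N) * (V ⊗ₖ V)ᴴ) := by
    rw [Matrix.conjTranspose_kronecker, Matrix.mul_assoc, ← swapAB_mul_kronecker,
      ← Matrix.mul_assoc, Matrix.mul_assoc (V ⊗ₖ V), swapDiff_mul_swapAB, mul_neg, neg_mul]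
  have htr : ((V ⊗ₖ V) * swapDiff (Fin N) * (V ⊗ₖ V)ᴴ).trace = 0 := by
    rw [Matrix.trace_mul_comm, ← Matrix.mul_assoc, hVV, Matrix.one_mul, trace_swapDiff]
  have h := map_localTwirl ν ((V ⊗ₖ V) * swapDiff (Fin N) * (V ⊗ₖ V)ᴴ)
    (Matrix.traceLinearMap _ ℂ ℂ ∘ₗ LinearMap.mulRight ℂ (swapDiff (Fin N)) ∘ₗ
      LinearMap.mulLeftRight ℂ (U ⊗ₖ U, (U ⊗ₖ U)ᴴ))
  simp only [LinearMap.comp_apply, LinearMap.mulRight_apply, LinearMap.mulLeftRight_apply,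
    Matrix.traceLinearMap_apply] at h
  rw [localTwirl_eq_smul_swapDiff ν _ hanti htr, Matrix.mul_smul, Matrix.smul_mul,
    Matrix.smul_mul, Matrix.trace_smul, smul_eq_mul, ← swapDiffOverlap, ← swapDiffOverlap] at h
  rw [mul_comm (swapDiffOverlap N U), mul_div_right_comm, h]
  refine integral_congr_ae (.of_forall fun g => ?_)
  simp only [swapDiffOverlap, localPair, Matrix.mul_kronecker_mul, Matrix.conjTranspose_mul,
    Matrix.mul_assoc]

lemma integral_one_sub_gateTyp (hN : 2 ≤ N)
    (ν : Measure (Matrix.unitaryGroup (Fin N) ℂ × Matrix.unitaryGroup (Fin N) ℂ))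
    [IsProbabilityMeasure ν] [ν.IsMulLeftInvariant]
    (U : Matrix (Fin N × Fin N) (Fin N × Fin N) ℂ) {V : Matrix (Fin N × Fin N) (Fin N × Fin N) ℂ}
    (hV : V ∈ Matrix.unitaryGroup (Fin N × Fin N) ℂ) :
    ∫ g, (1 - gateTyp N (U * ((g.1 : Matrix (Fin N) (Fin N) ℂ) ⊗ₖ
        (g.2 : Matrix (Fin N) (Fin N) ℂ)) * V)) ∂ν = (1 - gateTyp N U) * (1 - gateTyp N V) := by
  rw [← Complex.ofReal_inj, ← integral_complex_ofReal, Complex.ofReal_mul]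
  simp only [one_sub_gateTyp hN]
  rw [integral_div, integral_swapDiffOverlap hN ν U hV]
  ring

lemma continuous_gateTyp (hN : 2 ≤ N) : Continuous (gateTyp N) := by
  have h : gateTyp N = fun V =>
      1 - (swapDiffOverlap N V / (swapDiff (Fin N) * swapDiff (Fin N)).trace).re := by
    funext V
    rw [← one_sub_gateTyp hN, Complex.ofReal_re, sub_sub_cancel]
  have hk : Continuous fun V : Matrix (Fin N × Fin N) (Fin N × Fin N) ℂ => V ⊗ₖ V :=
    continuous_id.matrix_kroneckerMap_mul continuous_id
  rw [h]
  refine continuous_const.sub (Complex.continuous_re.comp (Continuous.div_const ?_ _))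
  exact (((hk.matrix_mul continuous_const).matrix_mul hk.matrix_conjTranspose).matrix_mul
    continuous_const).matrix_trace

section

variable {D : Type*} [Fintype D] [DecidableEq D] {U : Matrix D D ℂ}

lemma iterGate_mem_unitaryGroup (hU : U ∈ Matrix.unitaryGroup D ℂ) {W : ℕ → Matrix D D ℂ}
    (m : ℕ) (hW : ∀ k < m, W k ∈ Matrix.unitaryGroup D ℂ) :
    iterGate U W m ∈ Matrix.unitaryGroup D ℂ := by
  induction m with
  | zero => exact hU
  | succ m ih =>
    exact mul_mem (mul_mem hU (hW m m.lt_succ_self)) (ih fun k hk => hW k (hk.trans m.lt_succ_self))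

lemma iterGate_congr {W W' : ℕ → Matrix D D ℂ} (m : ℕ) (h : ∀ k < m, W k = W' k) :
    iterGate U W m = iterGate U W' m := by
  induction m with
  | zero => rfl
  | succ m ih =>
    rw [iterGate, iterGate, h m m.lt_succ_self, ih fun k hk => h k (hk.trans m.lt_succ_self)]

lemma continuous_iterGate {X : Type*} [TopologicalSpace X] {W : X → ℕ → Matrix D D ℂ}
    (hW : ∀ k, Continuous fun x => W x k) (m : ℕ) :
    Continuous fun x => iterGate U (W x) m := by
  induction m with
  | zero => exact continuous_const
  | succ m ih => exact (continuous_const.matrix_mul (hW m)).matrix_mul ih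

end

/-- The local gates with factors listed by `g`, continued by the identity. -/
def localGates {m : ℕ}
    (g : Fin m → Matrix.unitaryGroup (Fin N) ℂ × Matrix.unitaryGroup (Fin N) ℂ) (k : ℕ) :
    Matrix (Fin N × Fin N) (Fin N × Fin N) ℂ :=
  if h : k < m then
    ((g ⟨k, h⟩).1 : Matrix (Fin N) (Fin N) ℂ) ⊗ₖ ((g ⟨k, h⟩).2 : Matrix (Fin N) (Fin N) ℂ)
  else 1

lemma localGates_mem_unitaryGroup {m : ℕ}
    (g : Fin m → Matrix.unitaryGroup (Fin N) ℂ × Matrix.unitaryGroup (Fin N) ℂ) (k : ℕ) :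
    localGates g k ∈ Matrix.unitaryGroup (Fin N × Fin N) ℂ := by
  rw [localGates]
  split_ifs
  · exact Matrix.kronecker_mem_unitary (g _).1.2 (g _).2.2
  · exact one_mem _

lemma continuous_localGates {m : ℕ} (k : ℕ) :
    Continuous fun g : Fin m → Matrix.unitaryGroup (Fin N) ℂ × Matrix.unitaryGroup (Fin N) ℂ =>
      localGates g k := by
  by_cases h : k < m
  · simp only [localGates, dif_pos h]
    exact continuous_localGate.comp (continuous_apply _)
  · simp only [localGates, dif_neg h]
    exact continuous_const

lemma iterGate_localGates_insertNth_last {m : ℕ} (U : Matrix (Fin N × Fin N) (Fin N × Fin N) ℂ)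
    (x : Matrix.unitaryGroup (Fin N) ℂ × Matrix.unitaryGroup (Fin N) ℂ)
    (g : Fin m → Matrix.unitaryGroup (Fin N) ℂ × Matrix.unitaryGroup (Fin N) ℂ) :
    iterGate U (localGates ((Fin.last m).insertNth x g)) (m + 1) =
      U * ((x.1 : Matrix (Fin N) (Fin N) ℂ) ⊗ₖ (x.2 : Matrix (Fin N) (Fin N) ℂ)) *
        iterGate U (localGates g) m := by
  rw [iterGate, iterGate_congr m (W' := localGates g)]
  · congr 2
    rw [localGates, dif_pos m.lt_succ_self]
    have : (⟨m, m.lt_succ_self⟩ : Fin (m + 1)) = Fin.last m := rfl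
    rw [this, Fin.insertNth_apply_same]
  · intro k hk
    rw [localGates, localGates, dif_pos (hk.trans m.lt_succ_self), dif_pos hk]
    have : (⟨k, hk.trans m.lt_succ_self⟩ : Fin (m + 1)) = (Fin.last m).succAbove ⟨k, hk⟩ := by
      rw [Fin.succAbove_last]; rfl
    rw [this, Fin.insertNth_apply_succAbove]

lemma integral_one_sub_gateTyp_iterGate (hN : 2 ≤ N)
    (ν : Measure (Matrix.unitaryGroup (Fin N) ℂ × Matrix.unitaryGroup (Fin N) ℂ))
    [IsProbabilityMeasure ν] [ν.IsMulLeftInvariant]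
    {U : Matrix (Fin N × Fin N) (Fin N × Fin N) ℂ}
    (hU : U ∈ Matrix.unitaryGroup (Fin N × Fin N) ℂ) (m : ℕ) :
    ∫ g : Fin m → Matrix.unitaryGroup (Fin N) ℂ × Matrix.unitaryGroup (Fin N) ℂ,
        (1 - gateTyp N (iterGate U (localGates g) m)) ∂(Measure.pi fun _ => ν) =
      (1 - gateTyp N U) ^ (m + 1) := by
  induction m with
  | zero => simp [iterGate]
  | succ m ih =>
    have hmp := (measurePreserving_piFinSuccAbove (fun _ : Fin (m + 1) => ν) (Fin.last m)).symm
    have hc : Continuous fun z : (Matrix.unitaryGroup (Fin N) ℂ × Matrix.unitaryGroup (Fin N) ℂ) ×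
        (Fin m → Matrix.unitaryGroup (Fin N) ℂ × Matrix.unitaryGroup (Fin N) ℂ) =>
        1 - gateTyp N (U * ((z.1.1 : Matrix (Fin N) (Fin N) ℂ) ⊗ₖ
          (z.1.2 : Matrix (Fin N) (Fin N) ℂ)) * iterGate U (localGates z.2) m) :=
      continuous_const.sub ((continuous_gateTyp hN).comp
        ((continuous_const.matrix_mul (continuous_localGate.comp continuous_fst)).matrix_mul
          ((continuous_iterGate continuous_localGates m).comp continuous_snd)))
    rw [← hmp.integral_comp']
    have hcongr : ∀ z : (Matrix.unitaryGroup (Fin N) ℂ × Matrix.unitaryGroup (Fin N) ℂ) ×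
        (Fin m → Matrix.unitaryGroup (Fin N) ℂ × Matrix.unitaryGroup (Fin N) ℂ),
        iterGate U (localGates ((MeasurableEquiv.piFinSuccAbove
          (fun _ => Matrix.unitaryGroup (Fin N) ℂ × Matrix.unitaryGroup (Fin N) ℂ)
            (Fin.last m)).symm z)) (m + 1) =
        U * ((z.1.1 : Matrix (Fin N) (Fin N) ℂ) ⊗ₖ
          (z.1.2 : Matrix (Fin N) (Fin N) ℂ)) * iterGate U (localGates z.2) m :=
      fun z => iterGate_localGates_insertNth_last U z.1 z.2
    simp only [hcongr]
    refine (integral_prod_symm _ (integrable_of_continuous hc)).trans ?_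
    simp only [integral_one_sub_gateTyp hN ν U
      (iterGate_mem_unitaryGroup hU m fun k _ => localGates_mem_unitaryGroup _ k)]
    rw [integral_const_mul, ih, pow_succ' _ (m + 1)]

end IteratedGate

/-- For a unitary `U` on `ℂ^N ⊗ ℂ^N` and `n ≥ 1`, the average of the
gate-typicality of `U^(n) = U·W_{n-1}·U ⋯ W_1·U` over the interlacing local gates
`W_j = U^A_j ⊗ U^B_j`, with all local unitaries drawn independently from the Haar
probability measure on `U(N)`, equals `1 - (1 - g_t(U))^n`. -/
theorem gate_typicality_iterated_average (N : ℕ) (hN : 2 ≤ N)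
    (U : Matrix (Fin N × Fin N) (Fin N × Fin N) ℂ)
    (hU : U ∈ Matrix.unitaryGroup (Fin N × Fin N) ℂ)
    (μ : Measure (Matrix.unitaryGroup (Fin N) ℂ)) [μ.IsHaarMeasure] [IsProbabilityMeasure μ]
    (n : ℕ) (hn : 1 ≤ n) :
    (∫ g : Fin (n - 1) → Matrix.unitaryGroup (Fin N) ℂ × Matrix.unitaryGroup (Fin N) ℂ,
        gateTyp N (iterGate U
          (fun k => if h : k < n - 1 then
              ((g ⟨k, h⟩).1 : Matrix (Fin N) (Fin N) ℂ) ⊗ₖ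
                ((g ⟨k, h⟩).2 : Matrix (Fin N) (Fin N) ℂ)
            else 1) (n - 1))
        ∂(Measure.pi fun _ => μ.prod μ))
      = 1 - (1 - gateTyp N U) ^ n := by
  obtain ⟨m, rfl⟩ := Nat.exists_eq_add_of_le' hn
  have hint : Integrable (fun g : Fin m → Matrix.unitaryGroup (Fin N) ℂ ×
      Matrix.unitaryGroup (Fin N) ℂ => gateTyp N (iterGate U (localGates g) m))
      (Measure.pi fun _ => μ.prod μ) :=
    integrable_of_continuous
      ((continuous_gateTyp hN).comp (continuous_iterGate continuous_localGates m))
  rw [Nat.add_sub_cancel, ← integral_one_sub_gateTyp_iterGate hN (μ.prod μ) hU m,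
    integral_sub (integrable_const _) hint, integral_const, probReal_univ, one_smul,
    sub_sub_cancel]
  rfl
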